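/- There exists an oracle A ⊆ ℕ that computes a Schnorr random element of Cantor space 2^ω, is not high, and is of hyperimmune degree. -/

import Mathlib

open Filter

namespace CichonAnalog

/-! ### Oracle computability -/

/-- Partial functions `ℕ →. ℕ` partial recursive relative to the oracle `A ⊆ ℕ`.
This is Mathlib's `Nat.Partrec` with an extra base case for the characteristic
function of the oracle. -/
inductive RecursiveIn (A : Set ℕ) : (ℕ →. ℕ) → Prop
  | zero : RecursiveIn A (pure 0)
  | succ : RecursiveIn A ↑Nat.succ
  | left : RecursiveIn A ↑fun n : ℕ => n.unpair.1
  | right : RecursiveIn A ↑fun n : ℕ => n.unpair.2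
  | oracle : RecursiveIn A ↑fun n : ℕ => A.indicator (fun _ => 1) n
  | pair {f g} : RecursiveIn A f → RecursiveIn A g →
      RecursiveIn A fun n => Nat.pair <$> f n <*> g n
  | comp {f g} : RecursiveIn A f → RecursiveIn A g →
      RecursiveIn A fun n => g n >>= f
  | prec {f g} : RecursiveIn A f → RecursiveIn A g →
      RecursiveIn A (Nat.unpaired fun a n =>
        n.rec (f a) fun y IH => do let i ← IH; g (Nat.pair a (Nat.pair y i)))
  | rfind {f} : RecursiveIn A f →
      RecursiveIn A fun a => Nat.rfind fun n => (fun m => m = 0) <$> f (Nat.pair a n)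

/-- The partial function `f` (between coded spaces) is partial recursive in the oracle `A`. -/
def PartrecIn (A : Set ℕ) {α σ : Type} [Primcodable α] [Primcodable σ] (f : α →. σ) : Prop :=
  RecursiveIn A fun n =>
    Part.bind ↑(Encodable.decode (α := α) n) fun a => (f a).map Encodable.encode

/-- `f ≤_T A` : the (total) function `f` is computable from the oracle `A`. -/
def ComputableIn (A : Set ℕ) {α σ : Type} [Primcodable α] [Primcodable σ] (f : α → σ) : Prop :=
  PartrecIn A (f : α →. σ)

/-- `W` is computably enumerable in the oracle `A`. -/
def CEIn (A : Set ℕ) {α : Type} [Primcodable α] (W : Set α) : Prop :=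
  ∃ f : α →. ℕ, PartrecIn A f ∧ ∀ a, a ∈ W ↔ (f a).Dom

/-- `W` is computably enumerable (unrelativized). -/
def CE {α : Type} [Primcodable α] (W : Set α) : Prop :=
  ∃ f : α →. ℕ, Partrec f ∧ ∀ a, a ∈ W ↔ (f a).Dom

/-! ### Cantor space, `Π⁰₁` classes, effective meagerness -/

/-- The basic clopen set (cylinder) of the finite binary string `σ` in Cantor space. -/
def Cyl (σ : List Bool) : Set (ℕ → Bool) :=
  {x | ∀ i, i < σ.length → x i = σ.getD i false}

/-- `P` is a `Π⁰₁(A)` class: a closed subset of Cantor space whose complement is the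
union of basic clopen sets over a set of strings c.e. in `A`. -/
def Pi01In (A : Set ℕ) (P : Set (ℕ → Bool)) : Prop :=
  ∃ W : Set (List Bool), CEIn A W ∧ P = (⋃ σ ∈ W, Cyl σ)ᶜ

/-- `P` is a (plain) `Π⁰₁` class. -/
def Pi01 (P : Set (ℕ → Bool)) : Prop :=
  ∃ W : Set (List Bool), CE W ∧ P = (⋃ σ ∈ W, Cyl σ)ᶜ

/-- `C` is a uniformly `Π⁰₁(A)` sequence of classes. -/
def UnifPi01In (A : Set ℕ) (C : ℕ → Set (ℕ → Bool)) : Prop :=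
  ∃ W : Set (ℕ × List Bool), CEIn A W ∧
    ∀ m, C m = (⋃ σ ∈ {s | (m, s) ∈ W}, Cyl σ)ᶜ

/-- `C` is a uniformly `Π⁰₁` sequence of classes. -/
def UnifPi01 (C : ℕ → Set (ℕ → Bool)) : Prop :=
  ∃ W : Set (ℕ × List Bool), CE W ∧
    ∀ m, C m = (⋃ σ ∈ {s | (m, s) ∈ W}, Cyl σ)ᶜ

/-- `S` is effectively meager relative to `A`: it is contained in the union of a
uniformly `Π⁰₁(A)` sequence of nowhere dense classes. -/
def EffMeagerIn (A : Set ℕ) (S : Set (ℕ → Bool)) : Prop :=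
  ∃ C : ℕ → Set (ℕ → Bool), UnifPi01In A C ∧ (∀ m, IsNowhereDense (C m)) ∧ S ⊆ ⋃ m, C m

/-- `S` is effectively meager (unrelativized). -/
def EffMeager (S : Set (ℕ → Bool)) : Prop :=
  ∃ C : ℕ → Set (ℕ → Bool), UnifPi01 C ∧ (∀ m, IsNowhereDense (C m)) ∧ S ⊆ ⋃ m, C m

/-- `A` is meager engulfing: some `A`-effectively meager set contains every
effectively meager set. -/
def MeagerEngulfing (A : Set ℕ) : Prop :=
  ∃ S, EffMeagerIn A S ∧ ∀ T, EffMeager T → T ⊆ S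

/-- `A` is weakly meager engulfing: some `A`-effectively meager set contains every
computable element of Cantor space. -/
def WeaklyMeagerEngulfing (A : Set ℕ) : Prop :=
  ∃ S, EffMeagerIn A S ∧ ∀ x : ℕ → Bool, Computable x → x ∈ S

/-- `V` is a computable set of finite binary strings. -/
def ComputableStringSet (V : Set (List Bool)) : Prop :=
  ∃ χ : List Bool → Bool, Computable χ ∧ ∀ s, s ∈ V ↔ χ s = true

/-- `V` is a dense set of finite binary strings: every string has an extension in `V`. -/
def DenseStringSet (V : Set (List Bool)) : Prop :=
  ∀ σ : List Bool, ∃ τ ∈ V, σ <+: τ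

/-- `x ∈ 2^ω` is weakly 1-generic: for every computable dense set `V` of finite
binary strings, some initial segment of `x` lies in `V`. -/
def Weakly1Generic (x : ℕ → Bool) : Prop :=
  ∀ V : Set (List Bool), ComputableStringSet V → DenseStringSet V →
    ∃ n, (List.ofFn fun i : Fin n => x i) ∈ V

/-! ### Domination properties -/

/-- `A` is high: `A` computes a function dominating every total computable function. -/
def High (A : Set ℕ) : Prop :=
  ∃ f : ℕ → ℕ, ComputableIn A f ∧
    ∀ g : ℕ → ℕ, Computable g → ∀ᶠ n in atTop, g n ≤ f n

/-- `A` is of hyperimmune degree: `A` computes a function not dominated by any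
computable function. -/
def HyperimmuneDegree (A : Set ℕ) : Prop :=
  ∃ f : ℕ → ℕ, ComputableIn A f ∧
    ∀ g : ℕ → ℕ, Computable g → ∃ᶠ n in atTop, g n < f n

/-- `A` is of hyperimmune-free degree: every function computable in `A` is dominated
by a total computable function. -/
def HyperimmuneFree (A : Set ℕ) : Prop :=
  ∀ f : ℕ → ℕ, ComputableIn A f →
    ∃ g : ℕ → ℕ, Computable g ∧ ∀ᶠ n in atTop, f n ≤ g n

/-! ### Measure on Cantor space, Kurtz and Schnorr tests -/

open scoped Classical in
/-- The uniform measure of the clopen set `⋃ σ ∈ F, [σ]` determined by the finite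
list `F` of binary strings: count the binary strings of maximal length extending
some member of `F`, and normalize. -/
noncomputable def listMeasure (F : List (List Bool)) : ℚ :=
  letI k := (F.map List.length).foldr max 0
  ((Finset.univ.filter fun v : Fin k → Bool =>
      ∃ σ ∈ F, σ <+: List.ofFn v).card : ℚ) / 2 ^ k

/-- The clopen subset of Cantor space given explicitly as a finite union of
basic clopen sets. -/
def ClopSet (F : List (List Bool)) : Set (ℕ → Bool) := ⋃ σ ∈ F, Cyl σ

/-- The effectively open subset of Cantor space enumerated by the sequence of
finite stages `g`. -/
def OpenSet (g : ℕ → List (List Bool)) : Set (ℕ → Bool) := ⋃ s, ClopSet (g s)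

/-- The measure of the open set enumerated by the stages `g`: the supremum of the
measures of its finite partial unions. -/
noncomputable def openMeasure (g : ℕ → List (List Bool)) : ℝ :=
  ⨆ s : ℕ, (listMeasure ((List.range (s + 1)).flatMap g) : ℝ)

/-- A Kurtz test relative to `A`: an `A`-computable sequence of explicitly given
clopen sets, the `m`-th of measure at most `2 ^ (-m)`. -/
def KurtzTestIn (A : Set ℕ) (G : ℕ → List (List Bool)) : Prop :=
  ComputableIn A G ∧ ∀ m, listMeasure (G m) ≤ (1 / 2) ^ m

/-- A (plain) Kurtz test. -/
def KurtzTest (G : ℕ → List (List Bool)) : Prop :=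
  Computable G ∧ ∀ m, listMeasure (G m) ≤ (1 / 2) ^ m

/-- A Schnorr test relative to `A`: an `A`-computable doubly indexed sequence of finite
stages such that the `m`-th effectively open set `⋃ s, ClopSet (g m s)` has measure at
most `2 ^ (-m)`, and this measure is a real computable in `A` uniformly in `m`. -/
def SchnorrTestIn (A : Set ℕ) (g : ℕ → ℕ → List (List Bool)) : Prop :=
  ComputableIn A (fun p : ℕ × ℕ => g p.1 p.2) ∧
  (∀ m, openMeasure (g m) ≤ (1 / 2) ^ m) ∧
  ∃ q : ℕ × ℕ → ℚ, ComputableIn A q ∧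
    ∀ m k, |openMeasure (g m) - (q (m, k) : ℝ)| ≤ (1 / 2) ^ k

/-- A (plain) Schnorr test. -/
def SchnorrTest (g : ℕ → ℕ → List (List Bool)) : Prop :=
  Computable (fun p : ℕ × ℕ => g p.1 p.2) ∧
  (∀ m, openMeasure (g m) ≤ (1 / 2) ^ m) ∧
  ∃ q : ℕ × ℕ → ℚ, Computable q ∧
    ∀ m k, |openMeasure (g m) - (q (m, k) : ℝ)| ≤ (1 / 2) ^ k

/-- `N` is Schnorr null relative to `A`. -/
def SchnorrNullIn (A : Set ℕ) (N : Set (ℕ → Bool)) : Prop :=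
  ∃ g, SchnorrTestIn A g ∧ N ⊆ ⋂ m, OpenSet (g m)

/-- `N` is Schnorr null (unrelativized). -/
def SchnorrNull (N : Set (ℕ → Bool)) : Prop :=
  ∃ g, SchnorrTest g ∧ N ⊆ ⋂ m, OpenSet (g m)

/-- `x ∈ 2^ω` is Schnorr random: it belongs to no Schnorr null set. -/
def SchnorrRandom (x : ℕ → Bool) : Prop := ∀ N, SchnorrNull N → x ∉ N

/-- `A` is Kurtz engulfing: there is an `A`-computable sequence of Kurtz tests relative
to `A` such that every Kurtz null set is contained in the null set of one of them. -/
def KurtzEngulfing (A : Set ℕ) : Prop :=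
  ∃ G : ℕ → ℕ → List (List Bool),
    ComputableIn A (fun p : ℕ × ℕ => G p.1 p.2) ∧
    (∀ i m, listMeasure (G i m) ≤ (1 / 2) ^ m) ∧
    ∀ L, KurtzTest L → ∃ i, (⋂ m, ClopSet (L m)) ⊆ ⋂ m, ClopSet (G i m)

/-- `A` is weakly Kurtz engulfing: there is an `A`-computable sequence of Kurtz tests
relative to `A` such that the union of their null sets contains every computable
element of Cantor space. -/
def WeaklyKurtzEngulfing (A : Set ℕ) : Prop :=
  ∃ G : ℕ → ℕ → List (List Bool),
    ComputableIn A (fun p : ℕ × ℕ => G p.1 p.2) ∧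
    (∀ i m, listMeasure (G i m) ≤ (1 / 2) ^ m) ∧
    ∀ x : ℕ → Bool, Computable x → ∃ i, x ∈ ⋂ m, ClopSet (G i m)

/-- `A` is weakly Schnorr engulfing: some set Schnorr null relative to `A` contains
every computable element of Cantor space. -/
def WeaklySchnorrEngulfing (A : Set ℕ) : Prop :=
  ∃ N, SchnorrNullIn A N ∧ ∀ x : ℕ → Bool, Computable x → x ∈ N

/-! ### DNR and PA degrees -/

/-- The `e`-th partial computable function. -/
noncomputable def phi (e : ℕ) : ℕ →. ℕ := (Denumerable.ofNat Nat.Partrec.Code e).eval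

/-- `h` is diagonally nonrecursive. -/
def DNRFun (h : ℕ → ℕ) : Prop := ∀ e, ∀ y ∈ phi e e, h e ≠ y

/-- `A` is DNR: `A` computes a diagonally nonrecursive function. -/
def DNRDegree (A : Set ℕ) : Prop := ∃ h : ℕ → ℕ, ComputableIn A h ∧ DNRFun h

/-- `A` is PA: `A` computes a `{0,1}`-valued diagonally nonrecursive function. -/
def PA (A : Set ℕ) : Prop :=
  ∃ h : ℕ → ℕ, ComputableIn A h ∧ (∀ e, h e ≤ 1) ∧ DNRFun h

/-! ### Traces -/

/-- The trace `σ` (satisfying `|σ n| ≤ n`) traces the function `f` if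
`f n ∈ σ n` for all but finitely many `n`. -/
def Traces (σ : ℕ → Finset ℕ) (f : ℕ → ℕ) : Prop := ∀ᶠ n in atTop, f n ∈ σ n

/-- `σ` is a `(D, g)`-trace relative to `A`: `D` is infinite and c.e. in `A`, `g` is a
partial `A`-computable function with `D ⊆ dom g` and `g n ≥ n` on its domain, and `σ`
is partial `A`-computable, defined on `D`, with `|σ n| < g n` for all `n ∈ D`. -/
def IsDGTraceIn (A : Set ℕ) (D : Set ℕ) (g : ℕ →. ℕ) (σ : ℕ →. Finset ℕ) : Prop :=
  D.Infinite ∧ CEIn A D ∧ PartrecIn A g ∧ D ⊆ g.Dom ∧ (∀ n, ∀ y ∈ g n, n ≤ y) ∧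
  PartrecIn A σ ∧ D ⊆ σ.Dom ∧ ∀ n ∈ D, ∀ S ∈ σ n, ∀ b ∈ g n, S.card < b

/-- `σ` is a `(D, g)`-trace (unrelativized). -/
def IsDGTrace (D : Set ℕ) (g : ℕ →. ℕ) (σ : ℕ →. Finset ℕ) : Prop :=
  D.Infinite ∧ CE D ∧ Partrec g ∧ D ⊆ g.Dom ∧ (∀ n, ∀ y ∈ g n, n ≤ y) ∧
  Partrec σ ∧ D ⊆ σ.Dom ∧ ∀ n ∈ D, ∀ S ∈ σ n, ∀ b ∈ g n, S.card < b

/-- The `(D, g)`-trace `σ` traces `f`: `f n ∈ σ n` for all but finitely many `n ∈ D`. -/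
def DGTraces (D : Set ℕ) (σ : ℕ →. Finset ℕ) (f : ℕ → ℕ) : Prop :=
  ∀ᶠ n in atTop, n ∈ D → ∀ S ∈ σ n, f n ∈ S

/-- A monotone, continuous functional on partial oracles which is partial recursive uniformly in
any partial recursive family of oracles. -/
structure IsOperator (F : (ℕ →. ℕ) → ℕ →. ℕ) : Prop where
  mono : ∀ {o o' : ℕ →. ℕ}, (∀ n, o n ≤ o' n) → ∀ n, F o n ≤ F o' n
  cont : ∀ {o : ℕ → ℕ →. ℕ} {o' : ℕ →. ℕ}, (∀ n, Monotone fun k => o k n) →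
    (∀ n, ∀ y ∈ o' n, ∃ k, y ∈ o k n) → ∀ n, ∀ y ∈ F o' n, ∃ k, y ∈ F (o k) n
  partrec : ∀ {o : List Bool × List Bool → ℕ →. ℕ}, Partrec₂ o → Partrec₂ fun p => F (o p)

namespace IsOperator

variable {F G : (ℕ →. ℕ) → ℕ →. ℕ}

theorem mono_seq (hF : IsOperator F) {o : ℕ → ℕ →. ℕ} (ho : ∀ n, Monotone fun k => o k n) (n : ℕ) :
    Monotone fun k => F (o k) n :=
  fun _ _ hkl => hF.mono (fun m => ho m hkl) n

protected theorem const {f : ℕ →. ℕ} (hf : Nat.Partrec f) : IsOperator fun _ => f where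
  mono _ _ := le_rfl
  cont _ _ _ _ hy := ⟨0, hy⟩
  partrec _ := (Partrec.nat_iff.2 hf).comp Computable.snd

protected theorem id : IsOperator fun o => o where
  mono h := h
  cont _ h := h
  partrec h := h

theorem mem_pair {a b : Part ℕ} {y : ℕ} :
    y ∈ Nat.pair <$> a <*> b ↔ ∃ u ∈ a, ∃ v ∈ b, Nat.pair u v = y := by
  simp [Seq.seq, eq_comm]

protected theorem pair (hF : IsOperator F) (hG : IsOperator G) :
    IsOperator fun o n => Nat.pair <$> F o n <*> G o n where
  mono h n y hy := by
    obtain ⟨u, hu, v, hv, rfl⟩ := mem_pair.1 hy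
    exact mem_pair.2 ⟨u, hF.mono h n u hu, v, hG.mono h n v hv, rfl⟩
  cont ho h n y hy := by
    obtain ⟨u, hu, v, hv, rfl⟩ := mem_pair.1 hy
    obtain ⟨k, hk⟩ := hF.cont ho h n u hu
    obtain ⟨l, hl⟩ := hG.cont ho h n v hv
    exact ⟨max k l, mem_pair.2 ⟨u, hF.mono_seq ho n (le_max_left k l) u hk, v,
      hG.mono_seq ho n (le_max_right k l) v hl, rfl⟩⟩
  partrec {o} ho := by
    have h1 : Partrec₂ fun (p : (List Bool × List Bool) × ℕ) (_ : ℕ) => G (o p.1) p.2 :=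
      (hG.partrec ho).comp (Computable.fst.comp Computable.fst)
        (Computable.snd.comp Computable.fst)
    have h2 : Computable₂ fun (q : ((List Bool × List Bool) × ℕ) × ℕ) (v : ℕ) => Nat.pair q.2 v :=
      Primrec₂.natPair.to_comp.comp (Computable.snd.comp Computable.fst) Computable.snd
    have h3 : Partrec₂ fun (p : (List Bool × List Bool) × ℕ) (u : ℕ) =>
        (G (o p.1) p.2).map fun v => Nat.pair u v := Partrec.map h1 h2
    refine (Partrec.bind (hF.partrec ho) h3).of_eq fun p => Part.ext fun y => ?_
    rw [mem_pair]
    simp [eq_comm]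

protected theorem comp (hF : IsOperator F) (hG : IsOperator G) :
    IsOperator fun o n => G o n >>= F o where
  mono h n y hy := by
    obtain ⟨u, hu, hy⟩ := Part.mem_bind_iff.1 hy
    exact Part.mem_bind_iff.2 ⟨u, hG.mono h n u hu, hF.mono h u y hy⟩
  cont ho h n y hy := by
    obtain ⟨u, hu, hy⟩ := Part.mem_bind_iff.1 hy
    obtain ⟨k, hk⟩ := hG.cont ho h n u hu
    obtain ⟨l, hl⟩ := hF.cont ho h u y hy
    exact ⟨max k l, Part.mem_bind_iff.2 ⟨u, hG.mono_seq ho n (le_max_left k l) u hk,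
      hF.mono_seq ho u (le_max_right k l) y hl⟩⟩
  partrec ho :=
    Partrec.bind (hG.partrec ho) ((hF.partrec ho).comp (Computable.fst.comp Computable.fst)
      Computable.snd)

/-- Primitive recursion with partial base case and step. -/
def precPart (f g : ℕ →. ℕ) (a n : ℕ) : Part ℕ :=
  n.rec (f a) fun y IH => do let i ← IH; g (Nat.pair a (Nat.pair y i))

theorem mem_precPart_succ {f g : ℕ →. ℕ} {a n y : ℕ} :
    y ∈ precPart f g a (n + 1) ↔
      ∃ i ∈ precPart f g a n, y ∈ g (Nat.pair a (Nat.pair n i)) :=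
  Part.mem_bind_iff

protected theorem prec (hF : IsOperator F) (hG : IsOperator G) :
    IsOperator fun o => Nat.unpaired (precPart (F o) (G o)) := by
  have mono : ∀ {o o' : ℕ →. ℕ}, (∀ n, o n ≤ o' n) → ∀ a n,
      precPart (F o) (G o) a n ≤ precPart (F o') (G o') a n := by
    intro o o' h a n
    induction n with
    | zero => exact hF.mono h a
    | succ n ih =>
      intro y hy
      obtain ⟨i, hi, hy⟩ := mem_precPart_succ.1 hy
      exact mem_precPart_succ.2 ⟨i, ih i hi, hG.mono h _ y hy⟩
  refine ⟨fun h n => mono h _ _, fun {o o'} ho h n => ?_, fun {o} ho => ?_⟩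
  · suffices ∀ a n, ∀ y ∈ precPart (F o') (G o') a n, ∃ k, y ∈ precPart (F (o k)) (G (o k)) a n from
      this _ _
    intro a n
    induction n with
    | zero => exact hF.cont ho h a
    | succ n ih =>
      intro y hy
      obtain ⟨i, hi, hy⟩ := mem_precPart_succ.1 hy
      obtain ⟨k, hk⟩ := ih i hi
      obtain ⟨l, hl⟩ := hG.cont ho h _ y hy
      exact ⟨max k l, mem_precPart_succ.2 ⟨i, mono (fun m => ho m (le_max_left k l)) a n i hk,
        hG.mono_seq ho _ (le_max_right k l) y hl⟩⟩
  · have c : Computable fun q : (List Bool × List Bool) × ℕ => q.2.unpair :=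
      Computable.unpair.comp Computable.snd
    refine (Partrec.nat_rec (f := fun q : (List Bool × List Bool) × ℕ => q.2.unpair.2)
      (g := fun q => F (o q.1) q.2.unpair.1)
      (h := fun q r => G (o q.1) (Nat.pair q.2.unpair.1 (Nat.pair r.1 r.2)))
      (Computable.snd.comp c)
      ((hF.partrec ho).comp Computable.fst (Computable.fst.comp c)) ?_)
    refine (hG.partrec ho).comp (Computable.fst.comp Computable.fst) ?_
    exact Primrec₂.natPair.to_comp.comp (Computable.fst.comp (c.comp Computable.fst))
      (Primrec₂.natPair.to_comp.comp (Computable.fst.comp Computable.snd)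
        (Computable.snd.comp Computable.snd))

theorem mem_rfind_zero {f : ℕ →. ℕ} {a y : ℕ} :
    y ∈ Nat.rfind (fun n => (fun m => decide (m = 0)) <$> f (Nat.pair a n)) ↔
      0 ∈ f (Nat.pair a y) ∧ ∀ m < y, ∃ z ∈ f (Nat.pair a m), z ≠ 0 := by
  refine Nat.mem_rfind.trans ?_
  simp [Part.mem_map_iff]

protected theorem rfind (hF : IsOperator F) :
    IsOperator fun o a => Nat.rfind fun n => (fun m => decide (m = 0)) <$> F o (Nat.pair a n) where
  mono h n y hy := by
    obtain ⟨h0, h1⟩ := mem_rfind_zero.1 hy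
    refine mem_rfind_zero.2 ⟨hF.mono h _ _ h0, fun m hm => ?_⟩
    obtain ⟨z, hz, hz0⟩ := h1 m hm
    exact ⟨z, hF.mono h _ _ hz, hz0⟩
  cont {o o'} ho h n y hy := by
    obtain ⟨h0, h1⟩ := mem_rfind_zero.1 hy
    obtain ⟨k, hk⟩ := hF.cont ho h _ _ h0
    have h2 : ∀ m, ∃ l, m < y → ∃ z ∈ F (o l) (Nat.pair n m), z ≠ 0 := by
      intro m
      by_cases hm : m < y
      · obtain ⟨z, hz, hz0⟩ := h1 m hm
        obtain ⟨l, hl⟩ := hF.cont ho h _ _ hz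
        exact ⟨l, fun _ => ⟨z, hl, hz0⟩⟩
      · exact ⟨0, fun h => absurd h hm⟩
    choose l hl using h2
    refine ⟨max k ((Finset.range y).sup l), mem_rfind_zero.2
      ⟨hF.mono_seq ho _ (le_max_left _ _) _ hk, fun m hm => ?_⟩⟩
    obtain ⟨z, hz, hz0⟩ := hl m hm
    exact ⟨z, hF.mono_seq ho _ ((Finset.le_sup (Finset.mem_range.2 hm)).trans (le_max_right _ _))
      _ hz, hz0⟩
  partrec {o} ho := by
    refine Partrec.rfind (p := fun (q : (List Bool × List Bool) × ℕ) n =>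
      (fun m => decide (m = 0)) <$> F (o q.1) (Nat.pair q.2 n)) ?_
    refine Partrec.map ((hF.partrec ho).comp (Computable.fst.comp Computable.fst) ?_)
      (g := fun _ m => decide (m = 0)) ?_
    · exact Primrec₂.natPair.to_comp.comp (Computable.snd.comp Computable.fst) Computable.snd
    · exact ((Primrec.eq (α := ℕ)).decide.comp Primrec.snd (Primrec.const 0)).to_comp

end IsOperator

/-- The characteristic function of an oracle. -/
noncomputable def charFun (A : Set ℕ) : ℕ →. ℕ := ↑fun n : ℕ => A.indicator (fun _ => 1) n

theorem RecursiveIn.exists_isOperator {A : Set ℕ} {f : ℕ →. ℕ} (hf : RecursiveIn A f) :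
    ∃ F, IsOperator F ∧ F (charFun A) = f := by
  induction hf with
  | zero => exact ⟨_, .const .zero, rfl⟩
  | succ => exact ⟨_, .const .succ, rfl⟩
  | left => exact ⟨_, .const .left, rfl⟩
  | right => exact ⟨_, .const .right, rfl⟩
  | oracle => exact ⟨_, .id, rfl⟩
  | pair _ _ ihf ihg =>
    obtain ⟨F, hF, rfl⟩ := ihf
    obtain ⟨G, hG, rfl⟩ := ihg
    exact ⟨_, hF.pair hG, rfl⟩
  | comp _ _ ihf ihg =>
    obtain ⟨F, hF, rfl⟩ := ihf
    obtain ⟨G, hG, rfl⟩ := ihg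
    exact ⟨_, hF.comp hG, rfl⟩
  | prec _ _ ihf ihg =>
    obtain ⟨F, hF, rfl⟩ := ihf
    obtain ⟨G, hG, rfl⟩ := ihg
    exact ⟨_, hF.prec hG, rfl⟩
  | rfind _ ihf =>
    obtain ⟨F, hF, rfl⟩ := ihf
    exact ⟨_, hF.rfind, rfl⟩

theorem RecursiveIn.of_partrec {A : Set ℕ} {f : ℕ →. ℕ} (hf : Nat.Partrec f) : RecursiveIn A f := by
  induction hf with
  | zero => exact .zero
  | succ => exact .succ
  | left => exact .left
  | right => exact .right
  | pair _ _ ihf ihg => exact .pair ihf ihg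
  | comp _ _ ihf ihg => exact .comp ihf ihg
  | prec _ _ ihf ihg => exact .prec ihf ihg
  | rfind _ ihf => exact .rfind ihf

/-! ### Initial segments and joins -/

/-- The initial segment of length `k` of `x`. -/
def initSeg (x : ℕ → Bool) (k : ℕ) : List Bool := (List.range k).map x

@[simp]
theorem length_initSeg (x : ℕ → Bool) (k : ℕ) : (initSeg x k).length = k := by simp [initSeg]

@[simp]
theorem getElem_initSeg (x : ℕ → Bool) (k n : ℕ) (h : n < (initSeg x k).length) :
    (initSeg x k)[n] = x n := by
  simp [initSeg]

theorem getElem?_initSeg (x : ℕ → Bool) (k n : ℕ) :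
    (initSeg x k)[n]? = if n < k then some (x n) else none := by
  by_cases h : n < k <;> simp [initSeg, h]

theorem initSeg_eq_iff {x : ℕ → Bool} {u : List Bool} :
    initSeg x u.length = u ↔ ∀ i, (h : i < u.length) → x i = u[i] := by
  constructor
  · intro h i hi
    have : (initSeg x u.length)[i]? = u[i]? := by rw [h]
    simpa [getElem?_initSeg, hi] using this
  · intro h
    refine List.ext_getElem (by simp) fun i _ hi => ?_
    simp [initSeg, h i hi]

theorem take_initSeg (x : ℕ → Bool) {i k : ℕ} (h : i ≤ k) :
    (initSeg x k).take i = initSeg x i := by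
  simp [initSeg, ← List.map_take, List.take_range, h]

theorem initSeg_isPrefix_initSeg (x : ℕ → Bool) {i k : ℕ} (h : i ≤ k) :
    initSeg x i <+: initSeg x k := by
  rw [← take_initSeg x h]
  exact List.take_prefix _ _

theorem initSeg_eq_of_isPrefix {x : ℕ → Bool} {k : ℕ} {u : List Bool} (h : u <+: initSeg x k) :
    initSeg x u.length = u := by
  have := h.length_le
  rw [length_initSeg] at this
  rw [← take_initSeg x this]
  exact (List.prefix_iff_eq_take.1 h).symm

/-- The join of two elements of Cantor space, as an oracle. -/
def join (x G : ℕ → Bool) : Set ℕ := {n | (bif n.bodd then G else x) n.div2 = true}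

/-- The finite partial oracle determined by a pair of initial segments. -/
def finOracle (p : List Bool × List Bool) (n : ℕ) : Option ℕ :=
  ((bif n.bodd then p.2 else p.1)[n.div2]?).map Encodable.encode

theorem computable_finOracle : Computable₂ finOracle := by
  have h : Computable fun q : (List Bool × List Bool) × ℕ => q.2.bodd :=
    Computable.nat_bodd.comp Computable.snd
  have hl : Computable fun q : (List Bool × List Bool) × ℕ => bif q.2.bodd then q.1.2 else q.1.1 :=
    Computable.cond h (Computable.snd.comp Computable.fst) (Computable.fst.comp Computable.fst)
  exact Computable.option_map
    (Computable.list_getElem?.comp hl (Computable.nat_div2.comp Computable.snd))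
    (Computable.encode.comp Computable.snd)

theorem mem_charFun_join {x G : ℕ → Bool} {n y : ℕ} :
    y ∈ charFun (join x G) n ↔ Encodable.encode ((bif n.bodd then G else x) n.div2) = y := by
  classical
  have h0 : y ∈ (0 : Part ℕ) ↔ y = 0 := Part.mem_some_iff
  have h1 : y ∈ (1 : Part ℕ) ↔ y = 1 := Part.mem_some_iff
  simp only [charFun, Set.indicator, join, Set.mem_ofPred_eq]
  by_cases h : (bif n.bodd then G else x) n.div2 = true <;> simp [h, h0, h1, eq_comm]

theorem mem_finOracle_initSeg {x G : ℕ → Bool} {k n y : ℕ} :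
    y ∈ finOracle (initSeg x k, initSeg G k) n ↔
      n.div2 < k ∧ Encodable.encode ((bif n.bodd then G else x) n.div2) = y := by
  cases hn : n.bodd <;> by_cases h : n.div2 < k <;> simp [finOracle, hn, h]

/-- The code `c` computes `f` from the join of `x` and `G`, by way of their finite initial
segments. -/
def ComputesFrom (c : Nat.Partrec.Code) (x G : ℕ → Bool) (f : ℕ → ℕ) : Prop :=
  ∀ n y, y = f n ↔ ∃ k, y ∈ c.eval (Encodable.encode ((initSeg x k, initSeg G k), n))

/-- The use principle. -/
theorem exists_computesFrom {x G : ℕ → Bool} {f : ℕ → ℕ} (hf : ComputableIn (join x G) f) :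
    ∃ c, ComputesFrom c x G f := by
  have hf' : RecursiveIn (join x G) (f : ℕ →. ℕ) := by
    have h : RecursiveIn _ _ := hf
    simp only [Encodable.decode_nat, Part.coe_some, Part.bind_some, PFun.coe_val, Part.map_some,
      Encodable.encode_nat] at h
    exact h
  obtain ⟨F, hF, hFf⟩ := hf'.exists_isOperator
  have ho : Partrec₂ fun (p : List Bool × List Bool) (n : ℕ) => (finOracle p n : Part ℕ) :=
    computable_finOracle.ofOption
  have hp := hF.partrec ho
  obtain ⟨c, hc⟩ := Nat.Partrec.Code.exists_code.1 hp
  refine ⟨c, fun n y => ?_⟩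
  have hval : ∀ k, c.eval (Encodable.encode ((initSeg x k, initSeg G k), n)) =
      F (fun n => (finOracle (initSeg x k, initSeg G k) n : Part ℕ)) n := by
    intro k
    rw [hc]
    simp [Part.map_id', Part.bind_some]
  have hmem : y = f n ↔ y ∈ F (charFun (join x G)) n := by
    rw [hFf]; simp
  rw [hmem]
  simp only [hval]
  constructor
  · refine hF.cont (o := fun k n => (finOracle (initSeg x k, initSeg G k) n : Part ℕ))
      ?_ ?_ n y
    · intro n k l hkl z hz
      simp only [Part.mem_coe, mem_finOracle_initSeg] at hz ⊢
      exact ⟨hz.1.trans_le hkl, hz.2⟩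
    · intro n z hz
      refine ⟨n.div2 + 1, ?_⟩
      simp only [Part.mem_coe, mem_finOracle_initSeg]
      exact ⟨Nat.lt_succ_self _, mem_charFun_join.1 hz⟩
  · rintro ⟨k, hk⟩
    refine hF.mono (fun m z hz => ?_) n y hk
    simp only [Part.mem_coe, mem_finOracle_initSeg] at hz
    exact mem_charFun_join.2 hz.2

/-! ### Binary strings of given length -/

/-- The list of all binary strings of length `n`. -/
def strings : ℕ → List (List Bool)
  | 0 => [[]]
  | n + 1 => (strings n).map (List.cons false) ++ (strings n).map (List.cons true)

theorem mem_strings {n : ℕ} {u : List Bool} : u ∈ strings n ↔ u.length = n := by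
  induction n generalizing u with
  | zero => simp [strings]
  | succ n ih => rcases u with _ | ⟨b, u⟩ <;> [simp [strings]; cases b <;> simp [strings, ih]]

theorem nodup_strings (n : ℕ) : (strings n).Nodup := by
  induction n with
  | zero => simp [strings]
  | succ n ih =>
    refine List.Nodup.append (ih.map fun _ _ h => by simpa using h)
      (ih.map fun _ _ h => by simpa using h) fun u h1 h2 => ?_
    obtain ⟨v, -, rfl⟩ := List.mem_map.1 h1
    simp at h2

theorem length_strings (n : ℕ) : (strings n).length = 2 ^ n := by
  induction n with
  | zero => rfl
  | succ n ih => simp [strings, ih, pow_succ, mul_two]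

theorem primrec_strings : Primrec strings := by
  have h : Primrec₂ fun (_ : ℕ) (p : ℕ × List (List Bool)) =>
      p.2.map (List.cons false) ++ p.2.map (List.cons true) := by
    have hb : ∀ b : Bool, Primrec fun q : ℕ × (ℕ × List (List Bool)) => q.2.2.map (List.cons b) :=
      fun b => Primrec.list_map (Primrec.snd.comp Primrec.snd)
        (Primrec.list_cons.comp (Primrec.const b) Primrec.snd)
    exact Primrec.list_append.comp (hb false) (hb true)
  refine (Primrec.nat_rec' Primrec.id (Primrec.const [[]]) h).of_eq fun n => ?_
  induction n with
  | zero => rfl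
  | succ n ih => exact congrArg (fun l : List (List Bool) =>
      l.map (List.cons false) ++ l.map (List.cons true)) ih

/-! ### Generic elements of Cantor space -/

theorem exists_initSeg_eq (u : List Bool) : ∃ x : ℕ → Bool, initSeg x u.length = u :=
  ⟨fun i => u.getD i false, initSeg_eq_iff.2 fun i hi => by simp [hi]⟩

theorem initSeg_eq_initSeg_iff {x y : ℕ → Bool} {k : ℕ} :
    initSeg x k = initSeg y k ↔ x ∈ PiNat.cylinder y k := by
  simp [initSeg, PiNat.cylinder, List.map_inj_left]

theorem isOpen_initSeg_mem (k : ℕ) (T : Set (List Bool)) : IsOpen {x | initSeg x k ∈ T} := by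
  refine isOpen_iff_mem_nhds.2 fun x hx => ?_
  refine mem_of_superset ((PiNat.isOpen_cylinder _ x k).mem_nhds (PiNat.self_mem_cylinder x k)) ?_
  intro y hy
  rw [Set.mem_ofPred_eq, initSeg_eq_initSeg_iff.2 hy]
  exact hx

/-- `G` meets or avoids the set of strings `S`. -/
def Decides (G : ℕ → Bool) (S : Set (List Bool)) : Prop :=
  ∃ k, initSeg G k ∈ S ∨ ∀ τ, initSeg G k <+: τ → τ ∉ S

theorem exists_decides {ι : Type*} [Countable ι] (S : ι → Set (List Bool)) :
    ∃ G, ∀ i, Decides G (S i) := by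
  have h := dense_iInter_of_isOpen (f := fun i => {G | Decides G (S i)}) (fun i => ?_) fun i => ?_
  · obtain ⟨G, hG⟩ := h.nonempty
    exact ⟨G, fun i => Set.mem_iInter.1 hG i⟩
  · have : {G | Decides G (S i)} =
        ⋃ k, {G | initSeg G k ∈ S i ∪ {σ | ∀ τ, σ <+: τ → τ ∉ S i}} := by
      ext G; simp [Decides]
    rw [this]
    exact isOpen_iUnion fun k => isOpen_initSeg_mem k _
  · refine (PiNat.isTopologicalBasis_cylinders (fun _ : ℕ => Bool)).dense_iff.2 ?_
    rintro _ ⟨x, k, rfl⟩ -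
    by_cases h : ∃ τ ∈ S i, initSeg x k <+: τ
    · obtain ⟨τ, hτ, hx⟩ := h
      obtain ⟨G, hG⟩ := exists_initSeg_eq τ
      refine ⟨G, ?_, τ.length, Or.inl (hG.symm ▸ hτ)⟩
      rw [← hG] at hx
      simpa [initSeg_eq_initSeg_iff] using initSeg_eq_of_isPrefix hx
    · push Not at h
      exact ⟨x, PiNat.self_mem_cylinder x k, k, Or.inr fun τ hx hτ => h τ hτ hx⟩

theorem Decides.exists_mem {G : ℕ → Bool} {S : Set (List Bool)} (h : Decides G S) (k : ℕ)
    (hd : ∀ τ, initSeg G k <+: τ → ∃ ρ ∈ S, τ <+: ρ) : ∃ l, initSeg G l ∈ S := by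
  obtain ⟨l, hl | hl⟩ := h
  · exact ⟨l, hl⟩
  · obtain ⟨ρ, hρ, hp⟩ := hd (initSeg G (max k l)) (initSeg_isPrefix_initSeg G (le_max_left k l))
    exact absurd hρ (hl ρ ((initSeg_isPrefix_initSeg G (le_max_right k l)).trans hp))

/-! ### Search functions along generic elements -/

theorem exists_computable_choice {M : ℕ → ℕ → Prop} (hM : PrimrecRel M) (h : ∀ n, ∃ b, M n b) :
    ∃ g : ℕ → ℕ, Computable g ∧ ∀ n, M n (g n) := by
  classical
  obtain ⟨d, hd⟩ := hM
  have hp : Partrec fun n => Nat.rfind fun b => Part.some (decide (M n b)) := by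
    refine Partrec.rfind (p := fun n b => Part.some (decide (M n b))) ?_
    refine Computable₂.partrec₂ (f := fun n b => decide (M n b)) ?_
    exact hd.to_comp.of_eq fun p => by congr
  refine ⟨fun n => Nat.find (h n), hp.of_eq_tot fun n => ?_, fun n => Nat.find_spec (h n)⟩
  refine Nat.mem_rfind.2 ⟨by simpa using Nat.find_spec (h n), fun {m} hm => ?_⟩
  simpa using Nat.find_min (h n) hm

section Search

/-- Some initial segment of `τ` is `Q`-related to `n`. -/
def HasInitSeg (Q : List Bool → ℕ → Prop) (τ : List Bool) (n : ℕ) : Prop :=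
  ∃ i < τ.length + 1, Q (τ.take i) n

variable {Q : List Bool → ℕ → Prop}

theorem HasInitSeg.mono {τ ρ : List Bool} {n : ℕ} (h : HasInitSeg Q τ n) (hp : τ <+: ρ) :
    HasInitSeg Q ρ n := by
  obtain ⟨i, hi, hQ⟩ := h
  refine ⟨i, hi.trans_le (Nat.succ_le_succ hp.length_le), ?_⟩
  obtain ⟨w, rfl⟩ := hp
  rwa [List.take_append_of_le_length (by omega)]

theorem hasInitSeg_initSeg {G : ℕ → Bool} {k n : ℕ} :
    HasInitSeg Q (initSeg G k) n ↔ ∃ i ≤ k, Q (initSeg G i) n := by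
  simp only [HasInitSeg, length_initSeg, Nat.lt_succ_iff]
  exact exists_congr fun i => and_congr_right fun hi => by rw [take_initSeg G hi]

theorem primrecRel_hasInitSeg (hQ : PrimrecRel Q) : PrimrecRel (HasInitSeg Q) := by
  have h : PrimrecRel fun (i : ℕ) (p : List Bool × ℕ) => Q (p.1.take i) p.2 :=
    hQ.comp (Primrec.list_take.comp Primrec.fst (Primrec.fst.comp Primrec.snd))
      (Primrec.snd.comp Primrec.snd)
  have e : PrimrecRel fun (l : List ℕ) (p : List Bool × ℕ) => ∃ i ∈ l, Q (p.1.take i) p.2 :=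
    h.exists_mem_list
  refine (e.comp (Primrec.list_range.comp (Primrec.succ.comp
    (Primrec.list_length.comp Primrec.fst))) Primrec.id).of_eq fun p => ?_
  simp [HasInitSeg]

/-- The strings forcing that no initial segment is `Q`-related to `n`, for some `n`. -/
def forcesOut (Q : List Bool → ℕ → Prop) : Set (List Bool) :=
  {τ | ∃ n, ∀ ρ, τ <+: ρ → ¬HasInitSeg Q ρ n}

/-- The strings witnessing `Q`-search time at most `g n` for some `n ≥ N`. -/
def searchBelow (Q : List Bool → ℕ → Prop) (g : ℕ → ℕ) (N : ℕ) : Set (List Bool) :=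
  {τ | ∃ n ≥ N, τ.length ≤ g n ∧ HasInitSeg Q τ n}

/-- Along a generic `G`, if the search for an initial segment `Q`-related to `n` succeeds for
all `n`, then infinitely often it succeeds within a fixed computable time bound. -/
theorem search_of_decides {G : ℕ → Bool} (hQ : PrimrecRel Q) (h1 : Decides G (forcesOut Q))
    (h2 : ∀ g, Computable g → ∀ N, Decides G (searchBelow Q g N)) :
    (∃ n, ∀ k, ¬Q (initSeg G k) n) ∨
      ∃ g, Computable g ∧ ∀ N, ∃ n ≥ N, ∃ k ≤ g n, Q (initSeg G k) n := by
  obtain ⟨k, ⟨n, hn⟩ | hk⟩ := h1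
  · refine Or.inl ⟨n, fun l hl => hn _ (initSeg_isPrefix_initSeg G (le_max_left k l)) ?_⟩
    exact hasInitSeg_initSeg.2 ⟨l, le_max_right k l, hl⟩
  right
  set τ₀ := initSeg G k with hτ₀
  have hd : ∀ τ, τ₀ <+: τ → ∀ n, ∃ ρ, τ <+: ρ ∧ HasInitSeg Q ρ n := by
    intro τ hτ n
    by_contra! h
    exact hk τ hτ ⟨n, h⟩
  let M : ℕ → ℕ → Prop := fun n b =>
    ∀ v ∈ strings n, ∃ w ∈ strings b, HasInitSeg Q (τ₀ ++ v ++ w) n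
  have hM : PrimrecRel M := by
    have e1 : PrimrecRel fun (w : List Bool) (p : List Bool × ℕ) =>
        HasInitSeg Q (τ₀ ++ p.1 ++ w) p.2 :=
      (primrecRel_hasInitSeg hQ).comp
        (Primrec.list_append.comp (Primrec.list_append.comp (Primrec.const τ₀)
          (Primrec.fst.comp Primrec.snd)) Primrec.fst) (Primrec.snd.comp Primrec.snd)
    have e2 : PrimrecRel fun (v : List Bool) (p : ℕ × ℕ) =>
        ∃ w ∈ strings p.2, HasInitSeg Q (τ₀ ++ v ++ w) p.1 :=
      e1.exists_mem_list.comp (primrec_strings.comp (Primrec.snd.comp Primrec.snd))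
        (Primrec.pair Primrec.fst (Primrec.fst.comp Primrec.snd))
    exact e2.forall_mem_list.comp (primrec_strings.comp Primrec.fst)
      (Primrec.pair Primrec.fst Primrec.snd)
  have hMex : ∀ n, ∃ b, M n b := by
    intro n
    have : ∀ v, ∃ b, ∀ l ≥ b, ∃ w ∈ strings l, HasInitSeg Q (τ₀ ++ v ++ w) n := by
      intro v
      obtain ⟨_, ⟨w, rfl⟩, hw⟩ := hd (τ₀ ++ v) (List.prefix_append _ _) n
      refine ⟨w.length, fun l hl => ⟨w ++ List.replicate (l - w.length) false, ?_, ?_⟩⟩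
      · rw [mem_strings]; simp; omega
      · exact hw.mono (by simp [← List.append_assoc])
    choose b hb using this
    exact ⟨(strings n).toFinset.sup b, fun v hv => hb v _ (Finset.le_sup (by simpa using hv))⟩
  obtain ⟨g, hg, hMg⟩ := exists_computable_choice hM hMex
  have hadd : Computable₂ fun a b : ℕ => a + b := Primrec.nat_add.to_comp
  have hg' : Computable fun n => τ₀.length + n + g n :=
    hadd.comp (hadd.comp (Computable.const _) Computable.id) hg
  refine ⟨_, hg', fun N => ?_⟩
  obtain ⟨l, n, hn, hl, hQl⟩ := (h2 _ hg' N).exists_mem k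
    (by
      rintro _ ⟨v, rfl⟩
      set n := max N v.length with hn
      obtain ⟨w, hw, hQw⟩ := hMg n (v ++ List.replicate (n - v.length) false)
        (by rw [mem_strings]; simp; omega)
      rw [mem_strings] at hw
      refine ⟨_, ⟨n, le_max_left _ _, ?_, hQw⟩, ?_⟩
      · simp [hτ₀]; omega
      · simp only [← List.append_assoc, ← hτ₀]
        exact (List.prefix_append _ _).trans (List.prefix_append _ _))
  obtain ⟨i, hi, hQi⟩ := hasInitSeg_initSeg.1 hQl
  exact ⟨n, hn, i, hi.trans (by simpa using hl), hQi⟩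

end Search

/-! ### The uniform measure -/

open MeasureTheory in
/-- The uniform measure on Cantor space. -/
noncomputable def coin : Measure (ℕ → Bool) :=
  Measure.infinitePi fun _ => (PMF.uniformOfFintype Bool).toMeasure

instance : MeasureTheory.IsProbabilityMeasure coin := by
  unfold coin
  infer_instance

theorem coin_initSeg_eq (u : List Bool) :
    coin {x | initSeg x u.length = u} = (2 ^ u.length : ENNReal)⁻¹ := by
  have h : {x | initSeg x u.length = u} =
      Set.pi (Finset.range u.length) fun i => {u.getD i false} := by
    ext x
    simp only [Set.mem_ofPred_eq, initSeg_eq_iff, Set.mem_pi, Finset.mem_coe, Finset.mem_range,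
      Set.mem_singleton_iff]
    exact forall₂_congr fun i hi => by simp [hi]
  rw [h, coin, MeasureTheory.Measure.infinitePi_pi _ fun _ _ => MeasurableSet.singleton _]
  simp [ENNReal.inv_pow]

theorem measurableSet_initSeg_mem (k : ℕ) (T : Set (List Bool)) :
    MeasurableSet {x | initSeg x k ∈ T} :=
  (isOpen_initSeg_mem k T).measurableSet

theorem coin_initSeg_mem {k : ℕ} {T : Finset (List Bool)} (hT : ∀ u ∈ T, u.length = k) :
    coin {x | initSeg x k ∈ T} = T.card * (2 ^ k : ENNReal)⁻¹ := by
  have h : {x | initSeg x k ∈ T} = ⋃ u ∈ T, {x | initSeg x k = u} := by ext x; simp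
  rw [h, MeasureTheory.measure_biUnion_finset]
  · rw [Finset.sum_congr rfl fun u hu => ?_, Finset.sum_const, nsmul_eq_mul]
    rw [← hT u hu, coin_initSeg_eq u]
  · intro u _ v _ huv
    exact Set.disjoint_left.2 fun x hx hy => huv (hx.symm.trans hy)
  · exact fun u _ => measurableSet_initSeg_mem k {u}

theorem mem_Cyl {σ : List Bool} {x : ℕ → Bool} : x ∈ Cyl σ ↔ initSeg x σ.length = σ := by
  rw [initSeg_eq_iff]
  exact forall₂_congr fun i hi => by simp [hi]

theorem coin_clopSet (F : List (List Bool)) :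
    coin (ClopSet F) = ENNReal.ofReal (listMeasure F : ℝ) := by
  classical
  set k := (F.map List.length).foldr max 0 with hk
  have hF : ∀ σ ∈ F, σ.length ≤ k := fun σ hσ =>
    List.le_max_of_le' _ (List.mem_map_of_mem hσ) le_rfl
  set T : Finset (List Bool) := (Finset.univ.filter fun v : Fin k → Bool =>
      ∃ σ ∈ F, σ <+: List.ofFn v).image List.ofFn with hT
  have hS : ClopSet F = {x | initSeg x k ∈ T} := by
    ext x
    have hx : List.ofFn (fun i : Fin k => x i) = initSeg x k := by
      refine List.ext_getElem (by simp) fun i _ _ => by simp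
    simp only [ClopSet, Set.mem_iUnion, mem_Cyl, Set.mem_ofPred_eq, hT, Finset.mem_image,
      Finset.mem_filter, Finset.mem_univ, true_and, exists_prop]
    constructor
    · rintro ⟨σ, hσ, h⟩
      refine ⟨fun i => x i, ⟨σ, hσ, ?_⟩, hx⟩
      rw [hx, ← h]
      simpa using initSeg_isPrefix_initSeg x (hF σ hσ)
    · rintro ⟨v, ⟨σ, hσ, h⟩, hv⟩
      exact ⟨σ, hσ, initSeg_eq_of_isPrefix (hv ▸ h)⟩
  have hlen : ∀ u ∈ T, u.length = k := by
    intro u hu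
    obtain ⟨v, -, rfl⟩ := Finset.mem_image.1 hu
    simp
  rw [hS, coin_initSeg_mem hlen, hT, Finset.card_image_of_injective _ List.ofFn_injective]
  rw [listMeasure, ← hk]
  push_cast
  rw [ENNReal.ofReal_div_of_pos (by positivity), ENNReal.ofReal_natCast,
    ENNReal.ofReal_pow (by norm_num), ENNReal.ofReal_ofNat, div_eq_mul_inv]

theorem coin_openSet_le (g : ℕ → List (List Bool)) :
    coin (OpenSet g) ≤ ENNReal.ofReal (openMeasure g) := by
  have h : OpenSet g = ⋃ s, ClopSet ((List.range (s + 1)).flatMap g) := by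
    ext x
    simp only [OpenSet, ClopSet, Set.mem_iUnion, List.mem_flatMap, List.mem_range, exists_prop]
    constructor
    · rintro ⟨s, σ, hσ, hx⟩
      exact ⟨s, σ, ⟨s, Nat.lt_succ_self s, hσ⟩, hx⟩
    · rintro ⟨_, σ, ⟨s, -, hσ⟩, hx⟩
      exact ⟨s, σ, hσ, hx⟩
  have hm : Monotone fun s => ClopSet ((List.range (s + 1)).flatMap g) := by
    intro s t hst x
    simp only [ClopSet, Set.mem_iUnion, List.mem_flatMap, List.mem_range, exists_prop]
    rintro ⟨σ, ⟨r, hr, hσ⟩, hx⟩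
    exact ⟨σ, ⟨r, by omega, hσ⟩, hx⟩
  rw [h, hm.measure_iUnion]
  refine iSup_le fun s => ?_
  rw [coin_clopSet]
  refine ENNReal.ofReal_le_ofReal (le_ciSup (f := fun s : ℕ =>
    (listMeasure ((List.range (s + 1)).flatMap g) : ℝ)) ⟨1, ?_⟩ s)
  rintro _ ⟨s, rfl⟩
  rw [← ENNReal.ofReal_le_one, ← coin_clopSet]
  exact MeasureTheory.prob_le_one

theorem countable_computable {α σ : Type} [Primcodable α] [Primcodable σ] :
    {f : α → σ | Computable f}.Countable := by
  have h : ∀ f : {f : α → σ | Computable f}, ∃ c : Nat.Partrec.Code, c.eval = fun n =>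
      Part.bind ↑(Encodable.decode (α := α) n) fun a => ((f.1 : α →. σ) a).map Encodable.encode :=
    fun f => Nat.Partrec.Code.exists_code.1 f.2
  choose c hc using h
  refine Function.Injective.countable (f := c) fun f g hfg => Subtype.ext (funext fun a => ?_)
  have := congrFun ((hc f).symm.trans ((congrArg _ hfg).trans (hc g))) (Encodable.encode a)
  simpa using this

theorem ae_schnorrRandom : ∀ᵐ x ∂coin, SchnorrRandom x := by
  have h : ∀ f ∈ {f : ℕ × ℕ → List (List Bool) | Computable f}, ∀ᵐ x ∂coin,
      SchnorrTest (fun m s => f (m, s)) → x ∉ ⋂ m, OpenSet fun s => f (m, s) := by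
    intro f _
    by_cases hf : SchnorrTest fun m s => f (m, s)
    · simp only [hf, true_imp_iff]
      refine MeasureTheory.measure_eq_zero_iff_ae_notMem.1 (le_antisymm ?_ zero_le)
      refine ge_of_tendsto' (ENNReal.tendsto_pow_atTop_nhds_zero_of_lt_one
        (r := ENNReal.ofReal (1 / 2)) ?_) fun m => ?_
      · simp
      · refine (MeasureTheory.measure_mono (Set.iInter_subset _ m)).trans ?_
        rw [← ENNReal.ofReal_pow (by norm_num)]
        exact (coin_openSet_le _).trans (ENNReal.ofReal_le_ofReal (hf.2.1 m))
    · simp [hf]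
  filter_upwards [(MeasureTheory.ae_ball_iff countable_computable).2 h] with x hx N hN hxN
  obtain ⟨g, hg, hNg⟩ := hN
  exact hx (fun p => g p.1 p.2) hg.1 hg (hNg hxN)

/-- A weak form of the Lebesgue density theorem. -/
theorem exists_coin_lt_two_mul {D : Set (ℕ → Bool)} (hD : coin D ≠ 0) :
    ∃ σ : List Bool, coin {x | initSeg x σ.length = σ} <
      2 * coin (D ∩ {x | initSeg x σ.length = σ}) := by
  classical
  by_contra! h
  have hlt : coin D < 2 * coin D := by
    rw [two_mul]
    exact ENNReal.lt_add_right (MeasureTheory.measure_ne_top _ _) hD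
  obtain ⟨U, hDU, hU, hUD⟩ := Set.exists_isOpen_lt_of_lt D _ hlt
  let T : ℕ → Finset (List Bool) := fun k =>
    (strings k).toFinset.filter fun u => {y | initSeg y k = u} ⊆ U
  have hT : ∀ k x, initSeg x k ∈ T k ↔ {y | initSeg y k = initSeg x k} ⊆ U := by
    intro k x
    simp [T, mem_strings]
  have hlen : ∀ k, ∀ u ∈ T k, u.length = k := by
    intro k u hu
    simpa [mem_strings] using (Finset.mem_filter.1 hu).1
  let V : ℕ → Set (ℕ → Bool) := fun k => {x | initSeg x k ∈ T k}
  have hV : Monotone V := by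
    intro k l hkl x hx
    refine (hT l x).2 fun y hy => (hT k x).1 hx ?_
    rw [Set.mem_ofPred_eq] at hy ⊢
    rw [← take_initSeg y hkl, ← take_initSeg x hkl, hy]
  have hUV : U ⊆ ⋃ k, V k := by
    intro x hx
    obtain ⟨_, ⟨z, k, rfl⟩, hxz, hzU⟩ :=
      (PiNat.isTopologicalBasis_cylinders (fun _ : ℕ => Bool)).exists_subset_of_mem_open hx hU
    refine Set.mem_iUnion.2 ⟨k, (hT k x).2 fun y hy => hzU ?_⟩
    rw [← PiNat.mem_cylinder_iff_eq.1 hxz]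
    exact initSeg_eq_initSeg_iff.1 hy
  have hVU : ∀ k, V k ⊆ U := fun k x hx => (hT k x).1 hx rfl
  have hk : ∀ k, 2 * coin (D ∩ V k) ≤ coin (V k) := by
    intro k
    have h1 : D ∩ V k ⊆ ⋃ u ∈ T k, D ∩ {x | initSeg x u.length = u} := by
      rintro x ⟨hx, hk⟩
      refine Set.mem_biUnion hk ⟨hx, ?_⟩
      simp
    calc 2 * coin (D ∩ V k)
        ≤ 2 * ∑ u ∈ T k, coin (D ∩ {x | initSeg x u.length = u}) := by
          gcongr
          exact (MeasureTheory.measure_mono h1).trans (MeasureTheory.measure_biUnion_finset_le _ _)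
      _ = ∑ u ∈ T k, 2 * coin (D ∩ {x | initSeg x u.length = u}) := Finset.mul_sum _ _ _
      _ ≤ ∑ u ∈ T k, coin {x | initSeg x u.length = u} := Finset.sum_le_sum fun u _ => h u
      _ = coin (V k) := by
          rw [coin_initSeg_mem (hlen k), Finset.sum_congr rfl fun u hu => ?_, Finset.sum_const,
            nsmul_eq_mul]
          rw [coin_initSeg_eq, hlen k u hu]
  refine hUD.not_ge ?_
  have hDV : D = ⋃ k, D ∩ V k := by
    rw [← Set.inter_iUnion, Set.inter_eq_left.2 (hDU.trans hUV)]
  have hmono : Monotone fun k => D ∩ V k := fun k l hkl => Set.inter_subset_inter_right D (hV hkl)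
  rw [hDV, hmono.measure_iUnion, ENNReal.mul_iSup]
  exact iSup_le fun k => (hk k).trans (MeasureTheory.measure_mono (hVU k))

/-! ### Dominating functions computed with a generic oracle -/

section Generic

open Nat.Partrec (Code)

/-- The computation `c` with oracle a pair of prefixes of `u` and `ρ`, on input `n`, has been
seen to have a value less than `ρ.length`. -/
def Hits (c : Code) (ρ : List Bool) (n : ℕ) (u : List Bool) : Prop :=
  ∃ i < ρ.length + 1, ∃ y < ρ.length,
    Code.evaln ρ.length c (Encodable.encode ((u.take i, ρ.take i), n)) = some y

open scoped Classical in
/-- More than half of the strings extending `σ` by `ρ.length` bits satisfy `Hits`. -/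
def Majority (c : Code) (σ ρ : List Bool) (n : ℕ) : Prop :=
  (strings ρ.length).length <
    2 * ((strings ρ.length).filter fun w => Hits c ρ n (σ ++ w)).length

theorem primrecRel_hits (c : Code) (σ : List Bool) :
    PrimrecRel fun (w : List Bool) (p : List Bool × ℕ) => Hits c p.1 p.2 (σ ++ w) := by
  have hl : Primrec fun p : List Bool × List Bool × ℕ => p.2.1.length :=
    Primrec.list_length.comp (Primrec.fst.comp Primrec.snd)
  have e1 : PrimrecRel fun (y : ℕ) (p : ℕ × List Bool × List Bool × ℕ) =>
      Code.evaln p.2.2.1.length c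
        (Encodable.encode (((σ ++ p.2.1).take p.1, p.2.2.1.take p.1), p.2.2.2)) = some y := by
    have hi : Primrec fun q : ℕ × ℕ × List Bool × List Bool × ℕ => q.2.1 :=
      Primrec.fst.comp Primrec.snd
    have hp : Primrec fun q : ℕ × ℕ × List Bool × List Bool × ℕ => q.2.2 :=
      Primrec.snd.comp Primrec.snd
    have hρ : Primrec fun q : ℕ × ℕ × List Bool × List Bool × ℕ => q.2.2.2.1 :=
      Primrec.fst.comp (Primrec.snd.comp hp)
    refine Primrec.eq.comp (Code.primrec_evaln.comp (Primrec.pair (Primrec.pair (hl.comp hp)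
      (Primrec.const c)) (Primrec.encode.comp (Primrec.pair (Primrec.pair ?_ ?_) ?_))))
      (Primrec.option_some.comp Primrec.fst)
    · exact Primrec.list_take.comp hi
        (Primrec.list_append.comp (Primrec.const σ) (Primrec.fst.comp hp))
    · exact Primrec.list_take.comp hi hρ
    · exact Primrec.snd.comp (Primrec.snd.comp hp)
  have e2 : PrimrecRel fun (i : ℕ) (p : List Bool × List Bool × ℕ) =>
      ∃ y ∈ List.range p.2.1.length, Code.evaln p.2.1.length c
        (Encodable.encode (((σ ++ p.1).take i, p.2.1.take i), p.2.2)) = some y :=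
    e1.exists_mem_list.comp (Primrec.list_range.comp (hl.comp Primrec.snd)) Primrec.id
  refine (e2.exists_mem_list.comp (Primrec.list_range.comp (Primrec.succ.comp hl))
    Primrec.id).of_eq fun p => ?_
  simp [Hits]

theorem primrecRel_majority (c : Code) (σ : List Bool) : PrimrecRel (Majority c σ) := by
  classical
  have hs : Primrec fun p : List Bool × ℕ => strings p.1.length :=
    primrec_strings.comp (Primrec.list_length.comp Primrec.fst)
  refine (Primrec.nat_lt.comp (Primrec.list_length.comp hs) (Primrec.nat_mul.comp (Primrec.const 2)
    (Primrec.list_length.comp ((primrecRel_hits c σ).listFilter.comp hs Primrec.id)))).of_eq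
      fun p => ?_
  simp only [Majority]
  congr!

/-- The extensions of `σ` for which the computation `c` with oracle `G` on input `n` is seen to
have a value less than `L` by stage `L`. -/
def hitSet (c : Code) (σ : List Bool) (G : ℕ → Bool) (n L : ℕ) : Set (ℕ → Bool) :=
  {x | initSeg x σ.length = σ ∧ ∃ i ≤ L, ∃ y < L,
    Code.evaln L c (Encodable.encode ((initSeg x i, initSeg G i), n)) = some y}

theorem hitSet_mono (c : Code) (σ : List Bool) (G : ℕ → Bool) (n : ℕ) :
    Monotone (hitSet c σ G n) := by
  rintro L M hLM x ⟨hx, i, hi, y, hy, h⟩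
  exact ⟨hx, i, hi.trans hLM, y, hy.trans_le hLM, Code.evaln_mono hLM h⟩

theorem hitSet_subset (c : Code) (σ : List Bool) (G : ℕ → Bool) (n L : ℕ) :
    hitSet c σ G n L ⊆ {x | initSeg x σ.length = σ} := fun _ hx => hx.1

open scoped Classical in
theorem hitSet_eq (c : Code) (σ : List Bool) (G : ℕ → Bool) (n L : ℕ) :
    hitSet c σ G n L = {x | initSeg x (σ.length + L) ∈
      (((strings L).filter fun w => Hits c (initSeg G L) n (σ ++ w)).toFinset.image
        fun w => σ ++ w)} := by
  ext x
  have key : Hits c (initSeg G L) n (initSeg x (σ.length + L)) ↔ ∃ i ≤ L, ∃ y < L,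
      Code.evaln L c (Encodable.encode ((initSeg x i, initSeg G i), n)) = some y := by
    simp only [Hits, length_initSeg, Nat.lt_succ_iff]
    refine exists_congr fun i => and_congr_right fun hi => ?_
    rw [take_initSeg x (hi.trans (Nat.le_add_left _ _)), take_initSeg G hi]
  simp only [hitSet, Set.mem_ofPred_eq, ← key, Finset.mem_image, List.mem_toFinset, List.mem_filter,
    mem_strings, decide_eq_true_eq]
  constructor
  · rintro ⟨hx, h⟩
    obtain ⟨w, hw⟩ := hx ▸ initSeg_isPrefix_initSeg x (Nat.le_add_right σ.length L)
    refine ⟨w, ⟨?_, hw ▸ h⟩, hw⟩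
    have := congrArg List.length hw
    simp only [List.length_append, length_initSeg] at this
    omega
  · rintro ⟨w, ⟨-, h⟩, hw⟩
    exact ⟨initSeg_eq_of_isPrefix (hw ▸ List.prefix_append σ w), hw ▸ h⟩

theorem measurableSet_hitSet (c : Code) (σ : List Bool) (G : ℕ → Bool) (n L : ℕ) :
    MeasurableSet (hitSet c σ G n L) := by
  classical
  rw [hitSet_eq]
  exact measurableSet_initSeg_mem _ _

theorem majority_iff {c : Code} {σ : List Bool} {G : ℕ → Bool} {n L : ℕ} :
    Majority c σ (initSeg G L) n ↔
      coin {x | initSeg x σ.length = σ} < 2 * coin (hitSet c σ G n L) := by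
  classical
  set F := (strings L).filter fun w => Hits c (initSeg G L) n (σ ++ w) with hF
  have hc : coin (hitSet c σ G n L) = F.length * (2 ^ (σ.length + L) : ENNReal)⁻¹ := by
    rw [hitSet_eq, coin_initSeg_mem,
      Finset.card_image_of_injective _ (List.append_right_injective σ),
      List.toFinset_card_of_nodup ((nodup_strings L).filter _)]
    intro u hu
    simp only [Finset.mem_image, List.mem_toFinset, List.mem_filter, mem_strings] at hu
    obtain ⟨w, ⟨hw, -⟩, rfl⟩ := hu
    simp [hw]
  have hσ : (2 ^ σ.length : ENNReal)⁻¹ = (2 ^ L : ℕ) * (2 ^ (σ.length + L) : ENNReal)⁻¹ := by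
    rw [pow_add, ENNReal.mul_inv (by simp) (by simp), mul_left_comm, Nat.cast_pow, Nat.cast_ofNat,
      ENNReal.mul_inv_cancel (by simp) (by simp), mul_one]
  rw [coin_initSeg_eq, hc, hσ, ← mul_assoc,
    ENNReal.mul_lt_mul_iff_left (by simp) (by simp)]
  simp only [Majority, length_initSeg, length_strings]
  norm_cast

theorem ComputesFrom.exists_mem_hitSet {c : Code} {x G : ℕ → Bool} {f : ℕ → ℕ} {σ : List Bool}
    (h : ComputesFrom c x G f) (hx : initSeg x σ.length = σ) (n : ℕ) :
    ∃ L, x ∈ hitSet c σ G n L := by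
  obtain ⟨k, hk⟩ := (h n (f n)).1 rfl
  obtain ⟨s, hs⟩ := Code.evaln_complete.1 hk
  refine ⟨max (max k s) (f n + 1), hx, k, by simp, f n, by simp, ?_⟩
  exact Code.evaln_mono (by simp) hs

theorem ComputesFrom.lt_of_mem_hitSet {c : Code} {x G : ℕ → Bool} {f : ℕ → ℕ} {σ : List Bool}
    (h : ComputesFrom c x G f) {n L : ℕ} (hx : x ∈ hitSet c σ G n L) : f n < L := by
  obtain ⟨-, i, -, y, hy, he⟩ := hx
  rwa [← (h n y).2 ⟨i, Code.evaln_sound he⟩]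

theorem coin_dominating_eq_zero {c : Code} {G : ℕ → Bool}
    (h1 : ∀ σ, Decides G (forcesOut (Majority c σ)))
    (h2 : ∀ σ g, Computable g → ∀ N, Decides G (searchBelow (Majority c σ) g N)) :
    coin {x | ∃ f, ComputesFrom c x G f ∧
      ∀ g : ℕ → ℕ, Computable g → ∀ᶠ n in atTop, g n ≤ f n} = 0 := by
  by_contra h0
  obtain ⟨σ, hσ⟩ := exists_coin_lt_two_mul h0
  set D := {x | ∃ f, ComputesFrom c x G f ∧
      ∀ g : ℕ → ℕ, Computable g → ∀ᶠ n in atTop, g n ≤ f n}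
  rcases search_of_decides (primrecRel_majority c σ) (h1 σ) (h2 σ) with ⟨n, hn⟩ | ⟨g, hg, hgQ⟩
  · refine hσ.not_ge ?_
    have hsub : D ∩ {x | initSeg x σ.length = σ} ⊆ ⋃ L, hitSet c σ G n L := by
      rintro x ⟨⟨f, hf, -⟩, hx⟩
      exact Set.mem_iUnion.2 (hf.exists_mem_hitSet hx n)
    grw [hsub, (hitSet_mono c σ G n).measure_iUnion, ENNReal.mul_iSup]
    exact iSup_le fun L => not_lt.1 fun h => hn L (majority_iff.2 h)
  · let E : ℕ → Set (ℕ → Bool) := fun N =>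
      {x | initSeg x σ.length = σ ∧ ∃ f, ComputesFrom c x G f ∧ ∀ n ≥ N, g n ≤ f n}
    have hE : Monotone E := by
      rintro N M hNM x ⟨hx, f, hf, h⟩
      exact ⟨hx, f, hf, fun n hn => h n (hNM.trans hn)⟩
    have hsub : D ∩ {x | initSeg x σ.length = σ} ⊆ ⋃ N, E N := by
      rintro x ⟨⟨f, hf, hd⟩, hx⟩
      obtain ⟨N, hN⟩ := eventually_atTop.1 (hd g hg)
      exact Set.mem_iUnion.2 ⟨N, hx, f, hf, hN⟩
    grw [hsub, hE.measure_iUnion, ENNReal.mul_iSup, lt_iSup_iff] at hσ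
    obtain ⟨N, hN⟩ := hσ
    obtain ⟨n, hn, L, hL, hQ⟩ := hgQ N
    have hM := majority_iff.1 hQ
    have hdisj : Disjoint (E N) (hitSet c σ G n L) := by
      refine Set.disjoint_left.2 ?_
      rintro x ⟨-, f, hf, hx⟩ hx'
      exact ((hf.lt_of_mem_hitSet hx').trans_le hL).not_ge (hx n hn)
    have hle : coin (E N) + coin (hitSet c σ G n L) ≤ coin {x | initSeg x σ.length = σ} := by
      rw [← MeasureTheory.measure_union hdisj (measurableSet_hitSet c σ G n L)]
      exact MeasureTheory.measure_mono (Set.union_subset (fun x hx => hx.1) (hitSet_subset ..))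
    have := ENNReal.add_lt_add hN hM
    rw [← mul_add, ← two_mul] at this
    exact this.not_ge (by gcongr)

end Generic

/-! ### The oracle -/

theorem RecursiveIn.of_eq {A : Set ℕ} {f g : ℕ →. ℕ} (hf : RecursiveIn A f) (h : ∀ n, f n = g n) :
    RecursiveIn A g :=
  (funext h : f = g) ▸ hf

theorem recursiveIn_join_comp {x G : ℕ → Bool} {e : ℕ → ℕ} (he : Computable e) :
    RecursiveIn (join x G) ((fun n => Encodable.encode
      ((bif (e n).bodd then G else x) (e n).div2) : ℕ → ℕ) : ℕ →. ℕ) :=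
  (RecursiveIn.comp RecursiveIn.oracle (.of_partrec (Partrec.nat_iff.1 he.partrec))).of_eq fun n =>
    Part.eq_some_iff.2 (Part.mem_bind_iff.2 ⟨e n, Part.mem_some _, mem_charFun_join.2 rfl⟩)

theorem computableIn_join_left (x G : ℕ → Bool) : ComputableIn (join x G) x :=
  (recursiveIn_join_comp (x := x) (G := G) (e := fun n => 2 * n)
    (Primrec.nat_mul.comp (Primrec.const 2) Primrec.id).to_comp).of_eq fun n => by
      simp [Nat.bodd_mul]

theorem computableIn_join_find {x G : ℕ → Bool} (h : ∀ n, ∃ k, G (n + k) = false) :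
    ComputableIn (join x G) fun n => Nat.find (h n) := by
  refine (RecursiveIn.rfind (recursiveIn_join_comp (x := x) (G := G)
    (e := fun p => 2 * (p.unpair.1 + p.unpair.2) + 1)
    (Primrec.succ.comp (Primrec.nat_mul.comp (Primrec.const 2) (Primrec.nat_add.comp
      (Primrec.fst.comp Primrec.unpair) (Primrec.snd.comp Primrec.unpair)))).to_comp)).of_eq
        fun n => ?_
  refine (Part.eq_some_iff.2 ((IsOperator.mem_rfind_zero (y := Nat.find (h n))).2 ?_)).trans ?_
  rotate_left
  · simp
  · simp only [Nat.lt_find_iff]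
    refine ⟨by simp [Nat.find_spec (h n)], fun m hm => ?_⟩
    have h1 : G (n + m) = true := by simpa using hm m le_rfl
    simp [h1]

/-- The strings with a block of more than `g n` ones starting at some `n ≥ N`. -/
def longBlock (g : ℕ → ℕ) (N : ℕ) : Set (List Bool) :=
  {τ | ∃ n ≥ N, ∀ k ≤ g n, τ[n + k]? = some true}

/-- The strings with a zero at some `n ≥ N`. -/
def lateZero (N : ℕ) : Set (List Bool) := {τ | ∃ n ≥ N, τ[n]? = some false}

theorem hyperimmuneDegree_join {x G : ℕ → Bool}
    (h1 : ∀ g, Computable g → ∀ N, Decides G (longBlock g N)) (h2 : ∀ N, Decides G (lateZero N)) :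
    HyperimmuneDegree (join x G) := by
  have hz : ∀ n, ∃ k, G (n + k) = false := by
    intro N
    obtain ⟨l, n, hn, h⟩ := (h2 N).exists_mem 0 fun τ _ =>
      ⟨τ ++ List.replicate (N + 1) false, ⟨τ.length + N, by omega, by simp⟩, List.prefix_append _ _⟩
    obtain ⟨k, rfl⟩ := Nat.exists_eq_add_of_le hn
    refine ⟨k, ?_⟩
    simpa using (Option.ite_none_right_eq_some.1 ((getElem?_initSeg ..).symm.trans h)).2
  refine ⟨_, computableIn_join_find hz, fun g hg => frequently_atTop.2 fun N => ?_⟩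
  obtain ⟨l, n, hn, h⟩ := (h1 g hg N).exists_mem 0 fun τ _ =>
    ⟨τ ++ List.replicate (N + g (τ.length + N) + 1) true, ⟨τ.length + N, by omega, fun k hk => by
      rw [List.getElem?_append_right (by omega), List.getElem?_replicate, if_pos (by omega)]⟩,
      List.prefix_append _ _⟩
  refine ⟨n, hn, (Nat.lt_find_iff _ _).2 fun k hk => ?_⟩
  have := (Option.ite_none_right_eq_some.1 ((getElem?_initSeg ..).symm.trans (h k hk))).2
  simpa using this

theorem exists_generic : ∃ G : ℕ → Bool,
    (∀ c σ, Decides G (forcesOut (Majority c σ))) ∧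
    (∀ c σ g, Computable g → ∀ N, Decides G (searchBelow (Majority c σ) g N)) ∧
    (∀ g, Computable g → ∀ N, Decides G (longBlock g N)) ∧ ∀ N, Decides G (lateZero N) := by
  have : Countable {g : ℕ → ℕ // Computable g} := countable_computable.to_subtype
  obtain ⟨G, hG⟩ := exists_decides (ι := (Nat.Partrec.Code × List Bool) ⊕
      (Nat.Partrec.Code × List Bool × {g : ℕ → ℕ // Computable g} × ℕ) ⊕
      ({g : ℕ → ℕ // Computable g} × ℕ) ⊕ ℕ)
    (Sum.elim (fun p => forcesOut (Majority p.1 p.2))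
      (Sum.elim (fun p => searchBelow (Majority p.1 p.2.1) p.2.2.1 p.2.2.2)
        (Sum.elim (fun p => longBlock p.1 p.2) lateZero)))
  exact ⟨G, fun c σ => hG (.inl (c, σ)), fun c σ g hg N => hG (.inr (.inl (c, σ, ⟨g, hg⟩, N))),
    fun g hg N => hG (.inr (.inr (.inl (⟨g, hg⟩, N)))), fun N => hG (.inr (.inr (.inr N)))⟩

/-- there is an oracle computing a Schnorr random element of Cantor
space that is not high yet of hyperimmune degree. -/
theorem stmt17 :
    ∃ A : Set ℕ, (∃ x : ℕ → Bool, ComputableIn A x ∧ SchnorrRandom x) ∧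
      ¬ High A ∧ HyperimmuneDegree A := by
  obtain ⟨G, h1, h2, h3, h4⟩ := exists_generic
  have hD := MeasureTheory.ae_all_iff.2 fun c => MeasureTheory.measure_eq_zero_iff_ae_notMem.1
    (coin_dominating_eq_zero (h1 c) (h2 c))
  obtain ⟨x, hx, hxD⟩ := (ae_schnorrRandom.and hD).exists
  refine ⟨join x G, ⟨x, computableIn_join_left x G, hx⟩, ?_, hyperimmuneDegree_join h3 h4⟩
  rintro ⟨f, hf, hdom⟩
  obtain ⟨c, hc⟩ := exists_computesFrom hf
  exact hxD c ⟨f, hc, hdom⟩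

end CichonAnalog
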